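/- Let F be a field, E an associative unital F-algebra, m ≥ 1, and let d : {1,…,m} → ℕ_{≥1}. For each 1 ≤ i ≤ m let ρ_i : E →ₐ M_{d(i)}(F) be an F-algebra homomorphism, and for each pair 1 ≤ i < j ≤ m let σ_{j,i} : E → M_{d(j)×d(i)}(F) be an F-linear map into d(j)×d(i) matrices. Define η : E → M_D(F), where D = d(1)+⋯+d(m) and M_D(F) is identified with block matrices indexed by pairs from the disjoint union of the index sets, by letting the (j,i) block of η(x) be ρ_i(x) if j = i, σ_{j,i}(x) if j > i, and 0 if j < i. Then η is an F-algebra homomorphism if and only if for all 1 ≤ i < j ≤ m and all x, y ∈ E one has σ_{j,i}(xy) = ρ_j(x)·σ_{j,i}(y) + σ_{j,i}(x)·ρ_i(y) + Σ_{i<k<j} σ_{j,k}(x)·σ_{k,i}(y). -/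

import Mathlib

set_option synthInstance.maxHeartbeats 1000000
set_option maxHeartbeats 1000000

/-- The block lower-triangular map `η` with diagonal blocks `ρ_i(x)` and
below-diagonal blocks `σ_{j,i}(x)` (block row `j`, block column `i`, for `i < j`),
viewed as a `D × D` matrix indexed by the disjoint union `Σ i, Fin (d i)`. -/
noncomputable def blockLowerTri {F : Type*} [Field F] {E : Type*} [Ring E] [Algebra F E]
    {m : ℕ} (d : Fin m → ℕ)
    (ρ : (i : Fin m) → E →ₐ[F] Matrix (Fin (d i)) (Fin (d i)) F)
    (σ : (j : Fin m) → (i : Fin m) → E →ₗ[F] Matrix (Fin (d j)) (Fin (d i)) F)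
    (x : E) :
    Matrix ((i : Fin m) × Fin (d i)) ((i : Fin m) × Fin (d i)) F :=
  fun p q =>
    if h : p.1 = q.1 then ρ q.1 x (Fin.cast (congrArg d h) p.2) q.2
    else if q.1 < p.1 then σ p.1 q.1 x p.2 q.2 else 0

/-- Blocks of a product of matrices indexed by a sigma type. -/
theorem Matrix.submatrix_sigmaMk_mul {R ι : Type*} [NonUnitalNonAssocSemiring R] [Fintype ι]
    {α : ι → Type*} [∀ i, Fintype (α i)]
    (M N : Matrix ((i : ι) × α i) ((i : ι) × α i) R) (j i : ι) :
    (M * N).submatrix (Sigma.mk j) (Sigma.mk i) =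
      ∑ k, M.submatrix (Sigma.mk j) (Sigma.mk k) * N.submatrix (Sigma.mk k) (Sigma.mk i) := by
  ext a b
  simp [Matrix.mul_apply, Matrix.sum_apply, Fintype.sum_sigma]

theorem Matrix.ext_submatrix_sigmaMk {R ι : Type*} {α : ι → Type*}
    {M N : Matrix ((i : ι) × α i) ((i : ι) × α i) R}
    (h : ∀ j i, M.submatrix (Sigma.mk j) (Sigma.mk i) = N.submatrix (Sigma.mk j) (Sigma.mk i)) :
    M = N := by
  ext ⟨j, a⟩ ⟨i, b⟩
  exact congrFun (congrFun (h j i) a) b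

theorem Finset.sum_univ_eq_add_add_sum_Ioo {ι M : Type*} [Fintype ι] [LinearOrder ι]
    [LocallyFiniteOrder ι] [AddCommMonoid M] {i j : ι} (hij : i < j) (f : ι → M)
    (hf : ∀ k, k < i ∨ j < k → f k = 0) :
    ∑ k, f k = f j + f i + ∑ k ∈ Finset.Ioo i j, f k := by
  rw [← Finset.sum_subset (Finset.subset_univ (Finset.Icc i j)),
    ← Finset.Ico_insert_right hij.le, Finset.sum_insert Finset.right_notMem_Ico,
    ← Finset.Ioo_insert_left hij, Finset.sum_insert Finset.left_notMem_Ioo, add_assoc]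
  intro k _ hk
  rw [Finset.mem_Icc, not_and_or, not_le, not_le] at hk
  exact hf k hk

section blockLowerTri

variable {F : Type*} [Field F] {E : Type*} [Ring E] [Algebra F E] {m : ℕ} (d : Fin m → ℕ)
  (ρ : (i : Fin m) → E →ₐ[F] Matrix (Fin (d i)) (Fin (d i)) F)
  (σ : (j : Fin m) → (i : Fin m) → E →ₗ[F] Matrix (Fin (d j)) (Fin (d i)) F)

theorem blockLowerTri_submatrix_self (x : E) (i : Fin m) :
    (blockLowerTri d ρ σ x).submatrix (Sigma.mk i) (Sigma.mk i) = ρ i x := by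
  ext a b
  simp [blockLowerTri]

theorem blockLowerTri_submatrix_of_lt (x : E) {i j : Fin m} (h : i < j) :
    (blockLowerTri d ρ σ x).submatrix (Sigma.mk j) (Sigma.mk i) = σ j i x := by
  ext a b
  simp [blockLowerTri, h, h.ne']

theorem blockLowerTri_submatrix_of_gt (x : E) {i j : Fin m} (h : j < i) :
    (blockLowerTri d ρ σ x).submatrix (Sigma.mk j) (Sigma.mk i) = 0 := by
  ext a b
  simp [blockLowerTri, h.ne, h.not_gt]

theorem blockLowerTri_add (x y : E) :
    blockLowerTri d ρ σ (x + y) = blockLowerTri d ρ σ x + blockLowerTri d ρ σ y := by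
  ext ⟨j, a⟩ ⟨i, b⟩
  simp only [blockLowerTri, Matrix.add_apply, map_add]
  split_ifs <;> simp

theorem blockLowerTri_smul (c : F) (x : E) :
    blockLowerTri d ρ σ (c • x) = c • blockLowerTri d ρ σ x := by
  ext ⟨j, a⟩ ⟨i, b⟩
  simp only [blockLowerTri, Matrix.smul_apply, map_smul]
  split_ifs <;> simp

theorem blockLowerTri_mul_submatrix_self (x y : E) (i : Fin m) :
    (blockLowerTri d ρ σ x * blockLowerTri d ρ σ y).submatrix (Sigma.mk i) (Sigma.mk i) =
      ρ i x * ρ i y := by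
  rw [Matrix.submatrix_sigmaMk_mul, Fintype.sum_eq_single i]
  · simp only [blockLowerTri_submatrix_self]
  · intro k hk
    rcases hk.lt_or_gt with h | h
    · rw [blockLowerTri_submatrix_of_gt d ρ σ y h, Matrix.mul_zero]
    · rw [blockLowerTri_submatrix_of_gt d ρ σ x h, Matrix.zero_mul]

theorem blockLowerTri_mul_submatrix_of_gt (x y : E) {i j : Fin m} (hji : j < i) :
    (blockLowerTri d ρ σ x * blockLowerTri d ρ σ y).submatrix (Sigma.mk j) (Sigma.mk i) = 0 := by
  rw [Matrix.submatrix_sigmaMk_mul]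
  refine Finset.sum_eq_zero fun k _ => ?_
  rcases lt_or_ge k i with h | h
  · rw [blockLowerTri_submatrix_of_gt d ρ σ y h, Matrix.mul_zero]
  · rw [blockLowerTri_submatrix_of_gt d ρ σ x (hji.trans_le h), Matrix.zero_mul]

theorem blockLowerTri_mul_submatrix_of_lt (x y : E) {i j : Fin m} (hij : i < j) :
    (blockLowerTri d ρ σ x * blockLowerTri d ρ σ y).submatrix (Sigma.mk j) (Sigma.mk i) =
      ρ j x * σ j i y + σ j i x * ρ i y + ∑ k ∈ Finset.Ioo i j, σ j k x * σ k i y := by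
  rw [Matrix.submatrix_sigmaMk_mul, Finset.sum_univ_eq_add_add_sum_Ioo hij]
  · simp only [blockLowerTri_submatrix_self, blockLowerTri_submatrix_of_lt d ρ σ _ hij]
    congr 1
    refine Finset.sum_congr rfl fun k hk => ?_
    rw [Finset.mem_Ioo] at hk
    rw [blockLowerTri_submatrix_of_lt d ρ σ x hk.2, blockLowerTri_submatrix_of_lt d ρ σ y hk.1]
  · rintro k (h | h)
    · rw [blockLowerTri_submatrix_of_gt d ρ σ y h, Matrix.mul_zero]
    · rw [blockLowerTri_submatrix_of_gt d ρ σ x h, Matrix.zero_mul]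

/-- The off-diagonal blocks of a defining system vanish at `1`. -/
theorem apply_one_eq_zero_of_massey
    (H : ∀ i j : Fin m, i < j → ∀ x y : E,
      σ j i (x * y) = ρ j x * σ j i y + σ j i x * ρ i y +
        ∑ k ∈ Finset.Ioo i j, σ j k x * σ k i y) {i j : Fin m} (hij : i < j) :
    σ j i 1 = 0 := by
  induction j using WellFoundedLT.induction with
  | ind j ih =>
    have key := H i j hij 1 1
    rw [Finset.sum_eq_zero fun k hk => by
      rw [ih k (Finset.mem_Ioo.1 hk).2 (Finset.mem_Ioo.1 hk).1, Matrix.mul_zero]] at key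
    simpa using key

theorem blockLowerTri_one (hσ : ∀ i j : Fin m, i < j → σ j i 1 = 0) :
    blockLowerTri d ρ σ 1 = 1 := by
  refine Matrix.ext_submatrix_sigmaMk fun j i => ?_
  rcases lt_trichotomy i j with h | rfl | h
  · rw [blockLowerTri_submatrix_of_lt d ρ σ 1 h, hσ i j h]
    ext a b
    simp [h.ne']
  · rw [blockLowerTri_submatrix_self, map_one, Matrix.submatrix_one _ sigma_mk_injective]
  · rw [blockLowerTri_submatrix_of_gt d ρ σ 1 h]
    ext a b
    simp [h.ne]

/-- The block map is multiplicative exactly when the defining-system relations hold. -/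
theorem blockLowerTri_mul_iff :
    (∀ x y : E, blockLowerTri d ρ σ (x * y) = blockLowerTri d ρ σ x * blockLowerTri d ρ σ y) ↔
      (∀ i j : Fin m, i < j → ∀ x y : E,
        σ j i (x * y) = ρ j x * σ j i y + σ j i x * ρ i y +
          ∑ k ∈ Finset.Ioo i j, σ j k x * σ k i y) := by
  refine ⟨fun H i j hij x y => ?_, fun H x y => Matrix.ext_submatrix_sigmaMk fun j i => ?_⟩
  · rw [← blockLowerTri_mul_submatrix_of_lt d ρ σ x y hij, ← H,
      blockLowerTri_submatrix_of_lt d ρ σ _ hij]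
  · rcases lt_trichotomy i j with h | rfl | h
    · rw [blockLowerTri_mul_submatrix_of_lt d ρ σ x y h, blockLowerTri_submatrix_of_lt d ρ σ _ h,
        H i j h]
    · rw [blockLowerTri_mul_submatrix_self, blockLowerTri_submatrix_self, map_mul]
    · rw [blockLowerTri_mul_submatrix_of_gt d ρ σ x y h, blockLowerTri_submatrix_of_gt d ρ σ _ h]

end blockLowerTri

/-- Given representations `ρ_i : E →ₐ M_{d(i)}(F)` and `F`-linear
below-diagonal blocks `σ_{j,i} : E → M_{d(j)×d(i)}(F)` for `i < j`, the block
lower-triangular map `η` is an `F`-algebra homomorphism iff the Massey defining-system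
relations `σ_{j,i}(xy) = ρ_j(x)σ_{j,i}(y) + σ_{j,i}(x)ρ_i(y) + Σ_{i<k<j} σ_{j,k}(x)σ_{k,i}(y)`
hold for all `i < j` and all `x, y ∈ E`. -/
theorem stmt5 {F : Type*} [Field F] {E : Type*} [Ring E] [Algebra F E]
    (m : ℕ) (hm : 1 ≤ m) (d : Fin m → ℕ) (hd : ∀ i, 1 ≤ d i)
    (ρ : (i : Fin m) → E →ₐ[F] Matrix (Fin (d i)) (Fin (d i)) F)
    (σ : (j : Fin m) → (i : Fin m) → E →ₗ[F] Matrix (Fin (d j)) (Fin (d i)) F) :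
    (∃ ψ : E →ₐ[F] Matrix ((i : Fin m) × Fin (d i)) ((i : Fin m) × Fin (d i)) F,
        ∀ x : E, ψ x = blockLowerTri d ρ σ x) ↔
      (∀ i j : Fin m, i < j → ∀ x y : E,
        σ j i (x * y) = ρ j x * σ j i y + σ j i x * ρ i y +
          ∑ k ∈ Finset.Ioo i j, σ j k x * σ k i y) := by
  rw [← blockLowerTri_mul_iff]
  constructor
  · rintro ⟨ψ, hψ⟩ x y
    rw [← hψ, ← hψ, ← hψ, map_mul]
  · intro hmul
    have hone : blockLowerTri d ρ σ 1 = 1 := blockLowerTri_one d ρ σ fun _ _ hij =>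
      apply_one_eq_zero_of_massey d ρ σ ((blockLowerTri_mul_iff d ρ σ).1 hmul) hij
    let φ : E →ₗ[F] Matrix ((i : Fin m) × Fin (d i)) ((i : Fin m) × Fin (d i)) F :=
      { toFun := blockLowerTri d ρ σ
        map_add' := blockLowerTri_add d ρ σ
        map_smul' := blockLowerTri_smul d ρ σ }
    exact ⟨AlgHom.ofLinearMap φ hone hmul, fun _ => rfl⟩
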